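/- For every Borel probability measure F on [0,1], C(F) ≥ 0 (equivalently V(F⁻) + V(F⁺) ≤ 2·V(F)), and C(F) = 0 if and only if V(F) = 0. -/

import Mathlib

open MeasureTheory

/-- The binary entropy function `ℋ(p) = -p log₂ p - (1-p) log₂ (1-p)`. -/
noncomputable def binH (p : ℝ) : ℝ := -(p * Real.logb 2 p) - (1 - p) * Real.logb 2 (1 - p)

/-- `ℋ₂(p) = p (log₂ p)² + (1-p) (log₂ (1-p))²`. -/
noncomputable def binH2 (p : ℝ) : ℝ :=
  p * (Real.logb 2 p) ^ 2 + (1 - p) * (Real.logb 2 (1 - p)) ^ 2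

/-- The convolution `p ∗ q = pq + (1-p)(1-q)`. -/
noncomputable def pstar (p q : ℝ) : ℝ := p * q + (1 - p) * (1 - q)

/-- `(a₁,a₂) ↦ a₁∗a₂` as a map `[0,1]² → [0,1]`. -/
noncomputable def starMap (x : Set.Icc (0:ℝ) 1 × Set.Icc (0:ℝ) 1) : Set.Icc (0:ℝ) 1 :=
  ⟨pstar x.1 x.2, by
    obtain ⟨⟨p, hp0, hp1⟩, ⟨q, hq0, hq1⟩⟩ := x
    constructor <;> · simp only [pstar]; nlinarith⟩

/-- `(a₁,a₂) ↦ a₁a₂/(a₁∗a₂)` as a map `[0,1]² → [0,1]` (value `0` where the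
denominator vanishes, by the Lean convention `x / 0 = 0`). -/
noncomputable def plusMap₁ (x : Set.Icc (0:ℝ) 1 × Set.Icc (0:ℝ) 1) : Set.Icc (0:ℝ) 1 :=
  ⟨(x.1 : ℝ) * (x.2 : ℝ) / pstar x.1 x.2, by
    obtain ⟨⟨p, hp0, hp1⟩, ⟨q, hq0, hq1⟩⟩ := x
    have h0 : (0:ℝ) ≤ pstar p q := by simp only [pstar]; nlinarith
    refine ⟨div_nonneg (by nlinarith) h0, div_le_one_of_le₀ ?_ h0⟩
    simp only [pstar]; nlinarith⟩

/-- `(a₁,a₂) ↦ (1-a₁)a₂/((1-a₁)∗a₂)` as a map `[0,1]² → [0,1]`. -/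
noncomputable def plusMap₂ (x : Set.Icc (0:ℝ) 1 × Set.Icc (0:ℝ) 1) : Set.Icc (0:ℝ) 1 :=
  ⟨(1 - (x.1 : ℝ)) * (x.2 : ℝ) / pstar (1 - (x.1 : ℝ)) x.2, by
    obtain ⟨⟨p, hp0, hp1⟩, ⟨q, hq0, hq1⟩⟩ := x
    have h0 : (0:ℝ) ≤ pstar (1 - p) q := by simp only [pstar]; nlinarith
    refine ⟨div_nonneg (by nlinarith) h0, div_le_one_of_le₀ ?_ h0⟩
    simp only [pstar]; nlinarith⟩

/-- The varentropy functional `V(F) = ∫ℋ₂ dF - (∫ℋ dF)²` of a measure on `[0,1]`. -/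
noncomputable def VF (F : Measure (Set.Icc (0:ℝ) 1)) : ℝ :=
  (∫ a, binH2 (a : ℝ) ∂F) - (∫ a, binH (a : ℝ) ∂F) ^ 2

/-- `F⁻`: the pushforward of `F × F` under `(a₁,a₂) ↦ a₁∗a₂`. -/
noncomputable def Fminus (F : Measure (Set.Icc (0:ℝ) 1)) : Measure (Set.Icc (0:ℝ) 1) :=
  (F.prod F).map starMap

/-- `F⁺`: the sum of the pushforward under `(a₁,a₂) ↦ a₁a₂/(a₁∗a₂)` of the measure with
density `a₁∗a₂` w.r.t. `F × F`, and the pushforward under `(a₁,a₂) ↦ (1-a₁)a₂/((1-a₁)∗a₂)`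
of the measure with density `(1-a₁)∗a₂` w.r.t. `F × F`. -/
noncomputable def Fplus (F : Measure (Set.Icc (0:ℝ) 1)) : Measure (Set.Icc (0:ℝ) 1) :=
  ((F.prod F).withDensity (fun x => ENNReal.ofReal (pstar x.1 x.2))).map plusMap₁
    + ((F.prod F).withDensity
        (fun x => ENNReal.ofReal (pstar (1 - (x.1 : ℝ)) x.2))).map plusMap₂

/-- `C(F) = V(F) - (V(F⁻) + V(F⁺))/2`. -/
noncomputable def CF (F : Measure (Set.Icc (0:ℝ) 1)) : ℝ :=
  VF F - (VF (Fminus F) + VF (Fplus F)) / 2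

theorem binH_eq (p : ℝ) : binH p = Real.binEntropy p / Real.log 2 := by
  unfold binH Real.binEntropy Real.logb
  rw [Real.log_inv, Real.log_inv]
  ring

theorem binH_abs (a : ℝ) : binH a = binH (1/2 + |a - 1/2|) := by
  rcases abs_cases (a - 1/2) with ⟨h, _⟩ | ⟨h, _⟩
  · rw [h]; congr 1; ring
  · rw [h, binH_eq, binH_eq, ← Real.binEntropy_one_sub]; congr 2; ring

theorem binH_anti {s t : ℝ} (hs : 0 ≤ s) (hst : s ≤ t) (ht : t ≤ 1/2) :
    binH (1/2 + t) ≤ binH (1/2 + s) := by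
  rw [binH_eq, binH_eq]
  have h2 : 0 < Real.log 2 := Real.log_pos (by norm_num)
  apply div_le_div_of_nonneg_right _ h2.le
  apply Real.binEntropy_strictAntiOn.antitoneOn <;> first | constructor | skip
  all_goals norm_num
  all_goals linarith

theorem binH_lt {s t : ℝ} (hs : 0 ≤ s) (hst : s < t) (ht : t ≤ 1/2) :
    binH (1/2 + t) < binH (1/2 + s) := by
  rw [binH_eq, binH_eq]
  have h2 : 0 < Real.log 2 := Real.log_pos (by norm_num)
  apply div_lt_div_of_pos_right _ h2
  apply Real.binEntropy_strictAntiOn <;> first | constructor | skip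
  all_goals norm_num
  all_goals linarith

theorem abs_half {a : ℝ} (h0 : 0 ≤ a) (h1 : a ≤ 1) : |a - 1/2| ≤ 1/2 := by
  rw [abs_le]; constructor <;> linarith

theorem binH_le_sq {a b : ℝ} (h0 : 0 ≤ a) (h1 : a ≤ 1)
    (h : (b - 1/2)^2 ≤ (a - 1/2)^2) : binH a ≤ binH b := by
  rw [binH_abs a, binH_abs b]
  exact binH_anti (abs_nonneg _) (sq_le_sq.1 h) (abs_half h0 h1)

theorem binH_lt_sq {a b : ℝ} (h0 : 0 ≤ a) (h1 : a ≤ 1)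
    (h : (b - 1/2)^2 < (a - 1/2)^2) : binH a < binH b := by
  rw [binH_abs a, binH_abs b]
  exact binH_lt (abs_nonneg _) (sq_lt_sq.1 h) (abs_half h0 h1)

theorem binH_nonneg {a : ℝ} (h0 : 0 ≤ a) (h1 : a ≤ 1) : 0 ≤ binH a := by
  rw [binH_eq]
  exact div_nonneg (Real.binEntropy_nonneg h0 h1) (Real.log_pos (by norm_num)).le

theorem binH_le_one (a : ℝ) : binH a ≤ 1 := by
  rw [binH_eq]
  exact div_le_one_of_le₀ Real.binEntropy_le_log_two (Real.log_pos (by norm_num)).le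

theorem binH_concave : ConcaveOn ℝ (Set.Icc 0 1) binH := by
  have h := (Real.strictConcave_binEntropy.concaveOn).smul
    (inv_nonneg.2 (Real.log_pos (by norm_num : (1:ℝ) < 2)).le)
  have e : binH = fun x => (Real.log 2)⁻¹ • Real.binEntropy x := by
    funext p
    rw [binH_eq, smul_eq_mul, div_eq_inv_mul]
  rw [e]
  exact h

theorem four_pt {x y s t : ℝ} (hx : 0 ≤ x) (hy : y ≤ 1) (h1 : x ≤ s) (h2 : s ≤ y)
    (h : s + t = x + y) : binH x + binH y ≤ binH s + binH t := by
  rcases eq_or_lt_of_le (h1.trans h2) with e | e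
  · have : s = x := by linarith
    have : t = y := by linarith
    subst_vars; rfl
  · have hd : 0 < y - x := by linarith
    have hxy := binH_concave.2 (x := x) (y := y) ⟨hx, by linarith⟩ ⟨by linarith, hy⟩
    have A := hxy (a := (y - s)/(y-x)) (b := (s-x)/(y-x)) (div_nonneg (by linarith) hd.le)
      (div_nonneg (by linarith) hd.le) (by field_simp; ring)
    have B := hxy (b := (y - s)/(y-x)) (a := (s-x)/(y-x)) (div_nonneg (by linarith) hd.le)
      (div_nonneg (by linarith) hd.le) (by field_simp; ring)
    simp only [smul_eq_mul] at A B
    have e1 : (y - s)/(y-x) * x + (s-x)/(y-x) * y = s := by field_simp; ring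
    have e2 : (s-x)/(y-x) * x + (y - s)/(y-x) * y = t := by
      have : t = x + y - s := by linarith
      rw [this]; field_simp; ring
    rw [e1] at A
    rw [e2] at B
    have e3 : (y - s)/(y-x) + (s-x)/(y-x) = 1 := by field_simp; ring
    have e4 : binH x + binH y = ((y - s)/(y-x) + (s-x)/(y-x)) * (binH x + binH y) := by
      rw [e3]; ring
    rw [e4]
    linarith

theorem pstar_mem {a c : ℝ} (ha : 0 ≤ a) (ha1 : a ≤ 1) (hc : 0 ≤ c) (hc1 : c ≤ 1) :
    0 ≤ pstar a c ∧ pstar a c ≤ 1 := by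
  constructor <;> · simp only [pstar]; nlinarith

theorem pstar_half (a c : ℝ) : pstar a c - 1/2 = 2 * (a - 1/2) * (c - 1/2) := by
  unfold pstar; ring

theorem f_mono {a b c : ℝ} (ha : 0 ≤ a) (ha1 : a ≤ 1) (hc : 0 ≤ c) (hc1 : c ≤ 1)
    (h : (b - 1/2)^2 ≤ (a - 1/2)^2) : binH (pstar a c) ≤ binH (pstar b c) := by
  obtain ⟨h0, h1⟩ := pstar_mem ha ha1 hc hc1
  apply binH_le_sq h0 h1
  rw [pstar_half, pstar_half, mul_pow, mul_pow, mul_pow, mul_pow]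
  have := sq_nonneg (c - 1/2)
  nlinarith [mul_le_mul_of_nonneg_right h this]

/-- `H(U₂ | U₁)` -/
noncomputable def gg (a c : ℝ) : ℝ := binH a + binH c - binH (pstar a c)

theorem g_mono {a b c : ℝ} (ha : 0 ≤ a) (ha1 : a ≤ 1) (hc : 0 ≤ c) (hc1 : c ≤ 1)
    (h : (b - 1/2)^2 ≤ (a - 1/2)^2) : gg a c ≤ gg b c := by
  unfold gg
  rw [binH_abs a, binH_abs b, binH_abs (pstar a c), binH_abs (pstar b c), pstar_half, pstar_half,
    abs_mul, abs_mul, abs_mul, abs_mul, abs_two]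
  have hs := sq_le_sq.1 h
  have hs1 := abs_half ha ha1
  have hd := abs_half hc hc1
  have hb0 := abs_nonneg (b - 1/2)
  have hd0 := abs_nonneg (c - 1/2)
  generalize |a - 1/2| = s at *
  generalize |b - 1/2| = s' at *
  generalize |c - 1/2| = d at *
  have h1 : 0 ≤ s' * d := mul_nonneg hb0 hd0
  have h2 : s' * d ≤ s' * (1/2) := by gcongr
  have h3 : (s - s') * d ≤ (s - s') * (1/2) := by
    apply mul_le_mul_of_nonneg_left hd; linarith
  have A := four_pt (x := 1/2 + 2 * s' * d) (y := 1/2 + s) (s := 1/2 + s')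
    (t := 1/2 + (2 * s' * d + s - s')) (by linarith) (by linarith) (by linarith) (by linarith)
    (by ring)
  have B := binH_anti (s := 2 * s * d) (t := 2 * s' * d + s - s') (by nlinarith) (by linarith)
    (by linarith)
  linarith

theorem cond_H {m n p : ℝ} (hm : 0 ≤ m) (hn : 0 ≤ n) (hp : p = m + n) :
    p * binH (m / p) = -(m * (Real.logb 2 m - Real.logb 2 p) + n * (Real.logb 2 n - Real.logb 2 p))
    ∧ p * binH2 (m / p) =
      m * (Real.logb 2 m - Real.logb 2 p)^2 + n * (Real.logb 2 n - Real.logb 2 p)^2 := by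
  rcases (add_nonneg hm hn).eq_or_lt with h | h
  · have : m = 0 := by linarith
    have : n = 0 := by linarith
    subst_vars; simp
  · rw [← hp] at h
    have e : 1 - m / p = n / p := by field_simp; linarith
    have hpm : p * (m / p) = m := by field_simp
    have hpn : p * (n / p) = n := by field_simp
    unfold binH binH2
    rw [e]
    have key : ∀ x : ℝ, x = 0 ∨ Real.logb 2 (x / p) = Real.logb 2 x - Real.logb 2 p := by
      intro x
      by_cases hx : x = 0
      · exact Or.inl hx
      · exact Or.inr (Real.logb_div hx h.ne')
    constructor
    · rcases key m with r | r <;> rcases key n with r' | r' <;> simp only [r, r'] <;>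
        field_simp <;> simp <;> ring
    · rcases key m with r | r <;> rcases key n with r' | r' <;> simp only [r, r'] <;>
        field_simp <;> simp

theorem mul_logb_mul (k x y : ℝ) :
    k * (x * y) * Real.logb 2 (x * y) = k * (x * y) * (Real.logb 2 x + Real.logb 2 y) := by
  by_cases hx : x = 0
  · simp [hx]
  by_cases hy : y = 0
  · simp [hy]
  rw [Real.logb_mul hx hy]

/-- posterior given `U₁ = 0` -/
noncomputable def b0 (a c : ℝ) : ℝ := a * c / pstar a c
/-- posterior given `U₁ = 1` -/
noncomputable def b1 (a c : ℝ) : ℝ := (1 - a) * c / pstar (1 - a) c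

theorem pstar_one_sub (a c : ℝ) : pstar (1 - a) c = 1 - pstar a c := by unfold pstar; ring

/-- conditional covariance -/
noncomputable def KK (a c : ℝ) : ℝ :=
  pstar a c * (1 - pstar a c) * (Real.logb 2 (1 - pstar a c) - Real.logb 2 (pstar a c))
    * (binH (b0 a c) - binH (b1 a c))

theorem mul_logb_sub_sq (x y q : ℝ) :
    (x * y) * (Real.logb 2 (x * y) - q)^2 = (x * y) * (Real.logb 2 x + Real.logb 2 y - q)^2 := by
  by_cases hx : x = 0
  · simp [hx]
  by_cases hy : y = 0
  · simp [hy]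
  rw [Real.logb_mul hx hy]

theorem mul_logb_sub (x y q : ℝ) :
    (x * y) * (Real.logb 2 (x * y) - q) = (x * y) * (Real.logb 2 x + Real.logb 2 y - q) := by
  by_cases hx : x = 0
  · simp [hx]
  by_cases hy : y = 0
  · simp [hy]
  rw [Real.logb_mul hx hy]

theorem chain {a c : ℝ} (ha : 0 ≤ a) (ha1 : a ≤ 1) (hc : 0 ≤ c) (hc1 : c ≤ 1) :
    pstar a c * binH (b0 a c) + pstar (1 - a) c * binH (b1 a c) = gg a c ∧
    pstar a c * binH2 (b0 a c) + pstar (1 - a) c * binH2 (b1 a c) + binH2 (pstar a c)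
      + 2 * (KK a c + binH (pstar a c) * gg a c)
      = binH2 a + binH2 c + 2 * (binH a * binH c) := by
  have ha' : 0 ≤ 1 - a := by linarith
  have hc' : 0 ≤ 1 - c := by linarith
  obtain ⟨A1, A2⟩ := cond_H (m := a * c) (n := (1-a)*(1-c)) (p := pstar a c)
    (mul_nonneg ha hc) (mul_nonneg ha' hc') rfl
  obtain ⟨B1, B2⟩ := cond_H (m := (1-a) * c) (n := a*(1-c)) (p := pstar (1-a) c)
    (mul_nonneg ha' hc) (mul_nonneg ha hc') (by unfold pstar; ring)
  simp only [mul_logb_sub, mul_logb_sub_sq] at A1 A2 B1 B2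
  change pstar a c * binH (b0 a c) = _ at A1
  change pstar (1-a) c * binH (b1 a c) = _ at B1
  change pstar a c * binH2 (b0 a c) = _ at A2
  change pstar (1-a) c * binH2 (b1 a c) = _ at B2
  have C : pstar a c * binH (b0 a c) + pstar (1 - a) c * binH (b1 a c) = gg a c := by
    rw [A1, B1]
    unfold gg binH
    rw [pstar_one_sub]
    generalize Real.logb 2 (1 - pstar a c) = lq
    generalize Real.logb 2 (pstar a c) = lp
    unfold pstar
    ring
  refine ⟨C, ?_⟩
  have K1 : KK a c + binH (pstar a c) * gg a c =
      - Real.logb 2 (pstar a c) * (pstar a c * binH (b0 a c))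
      - Real.logb 2 (1 - pstar a c) * (pstar (1 - a) c * binH (b1 a c)) := by
    rw [← C]
    unfold KK
    rw [pstar_one_sub]
    have : binH (pstar a c) = -(pstar a c * Real.logb 2 (pstar a c)) -
      (1 - pstar a c) * Real.logb 2 (1 - pstar a c) := rfl
    rw [this]
    ring
  rw [K1, A1, A2, B1, B2]
  unfold binH2 binH
  rw [pstar_one_sub]
  generalize Real.logb 2 (1 - pstar a c) = lq
  generalize Real.logb 2 (pstar a c) = lp
  unfold pstar
  ring

theorem b_mem {a c : ℝ} (ha : 0 ≤ a) (ha1 : a ≤ 1) (hc : 0 ≤ c) (hc1 : c ≤ 1) :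
    (0 ≤ b0 a c ∧ b0 a c ≤ 1) ∧ (0 ≤ b1 a c ∧ b1 a c ≤ 1) :=
  ⟨(plusMap₁ (⟨a, ha, ha1⟩, ⟨c, hc, hc1⟩)).2, (plusMap₂ (⟨a, ha, ha1⟩, ⟨c, hc, hc1⟩)).2⟩

theorem b_diff {a c : ℝ} (hp : 0 < pstar a c) (hq : 0 < 1 - pstar a c) :
    ((b0 a c - 1/2)^2 - (b1 a c - 1/2)^2) * (pstar a c)^2 * (1 - pstar a c)^2 =
     (a - 1/2) * (c - 1/2) * (4 * (a * (1 - a)) * (c * (1 - c))) := by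
  have h0 : (b0 a c - 1/2) * pstar a c = (a + c - 1)/2 := by
    unfold b0; field_simp; unfold pstar; ring
  have h1 : (b1 a c - 1/2) * (1 - pstar a c) = (c - a)/2 := by
    unfold b1; rw [pstar_one_sub]; field_simp; unfold pstar; ring
  calc _ = ((b0 a c - 1/2) * pstar a c)^2 * (1 - pstar a c)^2
      - ((b1 a c - 1/2) * (1 - pstar a c))^2 * (pstar a c)^2 := by ring
    _ = _ := by rw [h0, h1]; unfold pstar; ring

theorem KK_nonneg {a c : ℝ} (ha : 0 ≤ a) (ha1 : a ≤ 1) (hc : 0 ≤ c) (hc1 : c ≤ 1) :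
    0 ≤ KK a c := by
  obtain ⟨hp, hq⟩ := pstar_mem ha ha1 hc hc1
  obtain ⟨⟨h1, h2⟩, h3, h4⟩ := b_mem ha ha1 hc hc1
  rcases hp.eq_or_lt with hp | hp
  · simp [KK, ← hp]
  rcases hq.eq_or_lt with hq | hq
  · simp [KK, hq]
  have hq' : 0 < 1 - pstar a c := by linarith
  have D := b_diff hp hq'
  have hh := pstar_half a c
  have hac : 0 ≤ 4 * (a * (1 - a)) * (c * (1 - c)) := by
    have := mul_nonneg ha (sub_nonneg.2 ha1)
    have := mul_nonneg hc (sub_nonneg.2 hc1)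
    positivity
  have hpq : 0 < (pstar a c)^2 * (1 - pstar a c)^2 := by positivity
  rw [mul_assoc] at D
  unfold KK
  rw [mul_assoc]
  apply mul_nonneg (by positivity)
  rcases le_total 0 ((a - 1/2) * (c - 1/2)) with h | h
  · have h5 : (b1 a c - 1/2)^2 ≤ (b0 a c - 1/2)^2 := by
      by_contra hcon
      push Not at hcon
      have := mul_nonneg h hac
      nlinarith
    have h6 := binH_le_sq h1 h2 h5
    have h7 : Real.logb 2 (1 - pstar a c) ≤ Real.logb 2 (pstar a c) :=
      Real.logb_le_logb_of_le (by norm_num) hq' (by linarith)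
    exact mul_nonneg_of_nonpos_of_nonpos (by linarith) (by linarith)
  · have h5 : (b0 a c - 1/2)^2 ≤ (b1 a c - 1/2)^2 := by
      by_contra hcon
      push Not at hcon
      have := mul_nonneg (neg_nonneg.2 h) hac
      nlinarith
    have h6 := binH_le_sq h3 h4 h5
    have h7 : Real.logb 2 (pstar a c) ≤ Real.logb 2 (1 - pstar a c) :=
      Real.logb_le_logb_of_le (by norm_num) hp (by linarith)
    exact mul_nonneg (by linarith) (by linarith)

theorem KK_pos {a c : ℝ} (ha : 0 < a) (ha1 : a < 1) (hc : 0 < c) (hc1 : c < 1)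
    (hah : a ≠ 1/2) (hch : c ≠ 1/2) : 0 < KK a c := by
  obtain ⟨⟨h1, h2⟩, h3, h4⟩ := b_mem ha.le ha1.le hc.le hc1.le
  have ha' : 0 < 1 - a := by linarith
  have hc' : 0 < 1 - c := by linarith
  have hp : 0 < pstar a c := by unfold pstar; positivity
  have hq' : 0 < 1 - pstar a c := by
    have : 1 - pstar a c = a * (1 - c) + (1 - a) * c := by unfold pstar; ring
    rw [this]; positivity
  have D := b_diff hp hq'
  have hh := pstar_half a c
  have hac : 0 < 4 * (a * (1 - a)) * (c * (1 - c)) := by positivity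
  have hpq : 0 < (pstar a c)^2 * (1 - pstar a c)^2 := by positivity
  rw [mul_assoc] at D
  unfold KK
  rw [mul_assoc]
  apply mul_pos (by positivity)
  have hne : (a - 1/2) * (c - 1/2) ≠ 0 := mul_ne_zero (sub_ne_zero.2 hah) (sub_ne_zero.2 hch)
  rcases hne.symm.lt_or_gt with h | h
  · have h5 : (b1 a c - 1/2)^2 < (b0 a c - 1/2)^2 := by
      by_contra hcon
      push Not at hcon
      have := mul_pos h hac
      nlinarith
    have h6 := binH_lt_sq h1 h2 h5
    have h7 : Real.logb 2 (1 - pstar a c) < Real.logb 2 (pstar a c) :=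
      Real.logb_lt_logb (by norm_num) hq' (by linarith)
    exact mul_pos_of_neg_of_neg (by linarith) (by linarith)
  · have h5 : (b0 a c - 1/2)^2 < (b1 a c - 1/2)^2 := by
      by_contra hcon
      push Not at hcon
      have := mul_pos (neg_pos.2 h) hac
      nlinarith
    have h6 := binH_lt_sq h3 h4 h5
    have h7 : Real.logb 2 (pstar a c) < Real.logb 2 (1 - pstar a c) :=
      Real.logb_lt_logb (by norm_num) hp (by linarith)
    exact mul_pos (by linarith) (by linarith)

theorem meas_binH : Measurable binH := by
  unfold binH Real.logb
  fun_prop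

theorem meas_binH2 : Measurable binH2 := by
  unfold binH2 Real.logb
  fun_prop

theorem mul_log_sq {x : ℝ} (h0 : 0 ≤ x) (h1 : x ≤ 1) :
    0 ≤ x * (Real.logb 2 x)^2 ∧ x * (Real.logb 2 x)^2 ≤ 4 / (Real.log 2)^2 := by
  refine ⟨by positivity, ?_⟩
  have h2 : 0 < Real.log 2 := Real.log_pos (by norm_num)
  rcases h0.eq_or_lt with h | h
  · rw [← h]; simp; positivity
  have hs := Real.abs_log_mul_self_lt (Real.sqrt x) (Real.sqrt_pos.2 h)
    (Real.sqrt_le_one.2 h1)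
  rw [Real.log_sqrt h0] at hs
  have h3 : (Real.log x / 2 * Real.sqrt x)^2 ≤ 1 := by
    rw [← sq_abs]; exact pow_le_one₀ (abs_nonneg _) hs.le
  rw [mul_pow, Real.sq_sqrt h0] at h3
  unfold Real.logb
  rw [div_pow, ← mul_div_assoc]
  gcongr
  nlinarith

theorem binH2_bound {x : ℝ} (h0 : 0 ≤ x) (h1 : x ≤ 1) :
    |binH2 x| ≤ 8 / (Real.log 2)^2 := by
  obtain ⟨a, b⟩ := mul_log_sq h0 h1
  obtain ⟨c, d⟩ := mul_log_sq (x := 1 - x) (by linarith) (by linarith)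
  unfold binH2
  rw [abs_of_nonneg (by linarith)]
  have : 8 / (Real.log 2)^2 = 4 / (Real.log 2)^2 + 4 / (Real.log 2)^2 := by ring
  linarith

theorem binH_bound {x : ℝ} (h0 : 0 ≤ x) (h1 : x ≤ 1) : |binH x| ≤ 1 := by
  rw [abs_of_nonneg (binH_nonneg h0 h1)]; exact binH_le_one x

theorem sq_le_binH2 {x : ℝ} (h0 : 0 ≤ x) (h1 : x ≤ 1) : binH x ^ 2 ≤ binH2 x := by
  have : binH2 x - binH x ^ 2 = x * (1 - x) * (Real.logb 2 x - Real.logb 2 (1 - x))^2 := by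
    unfold binH2 binH; ring
  have h : 0 ≤ x * (1 - x) * (Real.logb 2 x - Real.logb 2 (1 - x))^2 :=
    mul_nonneg (mul_nonneg h0 (by linarith)) (sq_nonneg _)
  linarith

theorem bint {α : Type*} [MeasurableSpace α] (μ : Measure α) [IsFiniteMeasure μ] {f : α → ℝ}
    (hf : Measurable f) (B : ℝ) (hB : ∀ x, |f x| ≤ B) : Integrable f μ :=
  Integrable.of_bound hf.aestronglyMeasurable B (Filter.Eventually.of_forall hB)

theorem chebyshev {α : Type*} [MeasurableSpace α] (μ : Measure α) [IsProbabilityMeasure μ]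
    {u v : α → ℝ} (hu : Integrable u μ) (hv : Integrable v μ)
    (huv : Integrable (fun x => u x * v x) μ)
    (h : ∀ a b, 0 ≤ (u a - u b) * (v a - v b)) :
    (∫ x, u x ∂μ) * (∫ x, v x ∂μ) ≤ ∫ x, u x * v x ∂μ := by
  have h1 : ∀ b, 0 ≤ (∫ x, u x * v x ∂μ) - u b * (∫ x, v x ∂μ) - v b * (∫ x, u x ∂μ) + u b * v b := by
    intro b
    have e : ∫ a, (u a - u b) * (v a - v b) ∂μ
        = (∫ x, u x * v x ∂μ) - u b * (∫ x, v x ∂μ) - v b * (∫ x, u x ∂μ) + u b * v b := by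
      have : ∀ a, (u a - u b) * (v a - v b) = u a * v a - u b * v a - v b * u a + u b * v b := by
        intro a; ring
      simp_rw [this]
      rw [integral_add, integral_sub, integral_sub, integral_const_mul, integral_const_mul]
      · simp
      · exact huv
      · exact hv.const_mul _
      · exact huv.sub (hv.const_mul _)
      · exact hu.const_mul _
      · exact (huv.sub (hv.const_mul _)).sub (hu.const_mul _)
      · exact integrable_const _
    rw [← e]
    exact integral_nonneg (fun a => h a b)
  have h2 := integral_nonneg (μ := μ) (f := fun b => (∫ x, u x * v x ∂μ) - u b * (∫ x, v x ∂μ)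
    - v b * (∫ x, u x ∂μ) + u b * v b) h1
  rw [integral_add, integral_sub, integral_sub, integral_mul_const, integral_mul_const] at h2
  · simp at h2
    linarith
  · exact integrable_const _
  · exact hu.mul_const _
  · exact (integrable_const _).sub (hu.mul_const _)
  · exact hv.mul_const _
  · exact ((integrable_const _).sub (hu.mul_const _)).sub (hv.mul_const _)
  · exact huv

theorem meas_starMap : Measurable starMap := by
  unfold starMap pstar
  apply Measurable.subtype_mk
  fun_prop

theorem meas_plus1 : Measurable plusMap₁ := by
  unfold plusMap₁ pstar
  apply Measurable.subtype_mk
  fun_prop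

theorem meas_plus2 : Measurable plusMap₂ := by
  unfold plusMap₂ pstar
  apply Measurable.subtype_mk
  fun_prop

theorem int_piece (μ : Measure (Set.Icc (0:ℝ) 1 × Set.Icc (0:ℝ) 1)) [IsFiniteMeasure μ]
    {w : Set.Icc (0:ℝ) 1 × Set.Icc (0:ℝ) 1 → ℝ} (hw : Measurable w) (h0 : ∀ x, 0 ≤ w x)
    (h1 : ∀ x, w x ≤ 1)
    {T : Set.Icc (0:ℝ) 1 × Set.Icc (0:ℝ) 1 → Set.Icc (0:ℝ) 1} (hT : Measurable T)
    {φ : ℝ → ℝ} (hφ : Measurable φ) (B : ℝ) (hB : ∀ x, 0 ≤ x → x ≤ 1 → |φ x| ≤ B) :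
    Integrable (fun a : Set.Icc (0:ℝ) 1 => φ a)
      ((μ.withDensity (fun x => ENNReal.ofReal (w x))).map T) ∧
    Integrable (fun x => w x * φ (T x)) μ ∧
    ∫ a, φ (a : ℝ) ∂((μ.withDensity (fun x => ENNReal.ofReal (w x))).map T)
      = ∫ x, w x * φ (T x) ∂μ := by
  have hwi : Integrable w μ := bint μ hw 1 (fun x => by rw [abs_of_nonneg (h0 x)]; exact h1 x)
  have : IsFiniteMeasure (μ.withDensity (fun x => ENNReal.ofReal (w x))) :=
    isFiniteMeasure_withDensity_ofReal hwi.2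
  have hm : Measurable (fun a : Set.Icc (0:ℝ) 1 => φ a) := hφ.comp measurable_subtype_coe
  refine ⟨bint _ hm B (fun x => hB _ x.2.1 x.2.2), ?_, ?_⟩
  · refine bint _ (hw.mul (hm.comp hT)) B (fun x => ?_)
    rw [abs_mul, abs_of_nonneg (h0 x)]
    have := hB _ (T x).2.1 (T x).2.2
    have := h0 x
    have := h1 x
    have := abs_nonneg (φ (T x))
    nlinarith
  · rw [integral_map hT.aemeasurable hm.aestronglyMeasurable,
      integral_withDensity_eq_integral_toReal_smul hw.ennreal_ofReal (by simp)]
    congr 1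
    ext x
    rw [ENNReal.toReal_ofReal (h0 x), smul_eq_mul]

section

variable (F : Measure (Set.Icc (0:ℝ) 1)) [IsProbabilityMeasure F]

theorem int_Fplus {φ : ℝ → ℝ} (hφ : Measurable φ) (B : ℝ)
    (hB : ∀ x, 0 ≤ x → x ≤ 1 → |φ x| ≤ B) :
    Integrable (fun x : Set.Icc (0:ℝ) 1 × Set.Icc (0:ℝ) 1 =>
      pstar x.1 x.2 * φ (b0 x.1 x.2) + pstar (1 - x.1) x.2 * φ (b1 x.1 x.2)) (F.prod F) ∧
    ∫ a, φ (a : ℝ) ∂(Fplus F) = ∫ x, (pstar (x.1:ℝ) x.2 * φ (b0 x.1 x.2)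
      + pstar (1 - (x.1:ℝ)) x.2 * φ (b1 x.1 x.2)) ∂(F.prod F) := by
  obtain ⟨A1, A2, A3⟩ := int_piece (F.prod F) (w := fun x => pstar x.1 x.2)
    (by unfold pstar; fun_prop)
    (fun x => (pstar_mem x.1.2.1 x.1.2.2 x.2.2.1 x.2.2.2).1)
    (fun x => (pstar_mem x.1.2.1 x.1.2.2 x.2.2.1 x.2.2.2).2) meas_plus1 hφ B hB
  obtain ⟨B1, B2, B3⟩ := int_piece (F.prod F) (w := fun x => pstar (1 - x.1) x.2)
    (by unfold pstar; fun_prop)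
    (fun x => (pstar_mem (sub_nonneg.2 x.1.2.2) (by linarith [x.1.2.1]) x.2.2.1 x.2.2.2).1)
    (fun x => (pstar_mem (sub_nonneg.2 x.1.2.2) (by linarith [x.1.2.1]) x.2.2.1 x.2.2.2).2)
    meas_plus2 hφ B hB
  refine ⟨A2.add B2, ?_⟩
  unfold Fplus
  rw [integral_add_measure A1 B1, A3, B3, ← integral_add A2 B2]
  rfl

theorem int_Fminus {φ : ℝ → ℝ} (hφ : Measurable φ) (B : ℝ)
    (hB : ∀ x, 0 ≤ x → x ≤ 1 → |φ x| ≤ B) :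
    Integrable (fun x : Set.Icc (0:ℝ) 1 × Set.Icc (0:ℝ) 1 => φ (pstar x.1 x.2)) (F.prod F) ∧
    ∫ a, φ (a : ℝ) ∂(Fminus F) = ∫ x, φ (pstar (x.1:ℝ) x.2) ∂(F.prod F) := by
  have hm : Measurable (fun a : Set.Icc (0:ℝ) 1 => φ a) := hφ.comp measurable_subtype_coe
  constructor
  · exact bint _ (hm.comp meas_starMap) B (fun x => hB _ (starMap x).2.1 (starMap x).2.2)
  · unfold Fminus
    rw [integral_map meas_starMap.aemeasurable hm.aestronglyMeasurable]
    rfl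

theorem meas_f : Measurable (fun x : Set.Icc (0:ℝ) 1 × Set.Icc (0:ℝ) 1 =>
    binH (pstar x.1 x.2)) :=
  (meas_binH.comp measurable_subtype_coe).comp meas_starMap

theorem meas_g : Measurable (fun x : Set.Icc (0:ℝ) 1 × Set.Icc (0:ℝ) 1 =>
    gg x.1 x.2) := by
  unfold gg
  refine Measurable.sub (Measurable.add ?_ ?_) meas_f
  · exact meas_binH.comp (by fun_prop)
  · exact meas_binH.comp (by fun_prop)

theorem f_bound (a c : Set.Icc (0:ℝ) 1) : |binH (pstar a c)| ≤ 1 :=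
  binH_bound (starMap (a, c)).2.1 (starMap (a, c)).2.2

theorem g_bound (a c : Set.Icc (0:ℝ) 1) : |gg a c| ≤ 3 := by
  have h1 := abs_le.1 (f_bound a c)
  have h2 := abs_le.1 (binH_bound a.2.1 a.2.2)
  have h3 := abs_le.1 (binH_bound c.2.1 c.2.2)
  unfold gg
  rw [abs_le]
  constructor <;> linarith [h1.1, h1.2, h2.1, h2.2, h3.1, h3.2]

theorem fg_bound (a c : Set.Icc (0:ℝ) 1) : |binH (pstar a c) * gg a c| ≤ 3 := by
  rw [abs_mul]
  nlinarith [f_bound a c, g_bound a c, abs_nonneg (binH (pstar a c)), abs_nonneg (gg a c)]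

theorem sec_abs {f : Set.Icc (0:ℝ) 1 → ℝ} {B : ℝ} (hB : ∀ x, |f x| ≤ B) :
    |∫ x, f x ∂F| ≤ B := by
  have := norm_integral_le_of_norm_le_const (μ := F) (f := f) (C := B)
    (Filter.Eventually.of_forall hB)
  simpa using this

theorem pstar_comm' (a c : ℝ) : pstar a c = pstar c a := by unfold pstar; ring

theorem gg_comm (a c : ℝ) : gg a c = gg c a := by unfold gg; rw [pstar_comm']; ring

theorem harris : (∫ x, binH (pstar (x.1:ℝ) x.2) ∂(F.prod F)) * (∫ x, gg x.1 x.2 ∂(F.prod F))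
    ≤ ∫ x, binH (pstar (x.1:ℝ) x.2) * gg x.1 x.2 ∂(F.prod F) := by
  have If := bint (F.prod F) meas_f 1 (fun x => f_bound x.1 x.2)
  have Ig := bint (F.prod F) meas_g 3 (fun x => g_bound x.1 x.2)
  have Ifg := bint (F.prod F) (meas_f.mul meas_g) 3 (fun x => fg_bound x.1 x.2)
  have Sf : ∀ a : Set.Icc (0:ℝ) 1, Integrable (fun c : Set.Icc (0:ℝ) 1 => binH (pstar a c)) F :=
    fun a => bint F (meas_f.comp measurable_prodMk_left) 1 (fun c => f_bound a c)
  have Sg : ∀ a : Set.Icc (0:ℝ) 1, Integrable (fun c : Set.Icc (0:ℝ) 1 => gg a c) F :=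
    fun a => bint F (meas_g.comp measurable_prodMk_left) 3 (fun c => g_bound a c)
  have Sfg : ∀ a : Set.Icc (0:ℝ) 1,
      Integrable (fun c : Set.Icc (0:ℝ) 1 => binH (pstar a c) * gg a c) F :=
    fun a => bint F ((meas_f.mul meas_g).comp measurable_prodMk_left) 3 (fun c => fg_bound a c)
  rw [integral_prod _ If, integral_prod _ Ig]
  erw [integral_prod _ Ifg]
  have mf : Measurable (fun a : Set.Icc (0:ℝ) 1 => ∫ c : Set.Icc (0:ℝ) 1, binH (pstar a c) ∂F) :=
    (meas_f.stronglyMeasurable.integral_prod_right').measurable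
  have mg : Measurable (fun a : Set.Icc (0:ℝ) 1 => ∫ c : Set.Icc (0:ℝ) 1, gg a c ∂F) :=
    (meas_g.stronglyMeasurable.integral_prod_right').measurable
  have bf : ∀ a : Set.Icc (0:ℝ) 1, |∫ c : Set.Icc (0:ℝ) 1, binH (pstar a c) ∂F| ≤ 1 :=
    fun a => sec_abs F (fun c => f_bound a c)
  have bg : ∀ a : Set.Icc (0:ℝ) 1, |∫ c : Set.Icc (0:ℝ) 1, gg a c ∂F| ≤ 3 :=
    fun a => sec_abs F (fun c => g_bound a c)
  have Iprod : Integrable (fun a : Set.Icc (0:ℝ) 1 => (∫ c : Set.Icc (0:ℝ) 1, binH (pstar a c) ∂F) *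
      (∫ c : Set.Icc (0:ℝ) 1, gg a c ∂F)) F := by
    refine bint F (mf.mul mg) 3 (fun a => ?_)
    rw [abs_mul]
    nlinarith [bf a, bg a, abs_nonneg (∫ c : Set.Icc (0:ℝ) 1, binH (pstar a c) ∂F),
      abs_nonneg (∫ c : Set.Icc (0:ℝ) 1, gg a c ∂F)]
  refine le_trans (chebyshev F (bint F mf 1 bf) (bint F mg 3 bg) Iprod ?_) ?_
  · intro a b
    rcases le_total (((a:ℝ) - 1/2)^2) (((b:ℝ) - 1/2)^2) with h | h
    · exact mul_nonneg
        (sub_nonneg.2 (integral_mono (Sf b) (Sf a)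
          (fun c => f_mono b.2.1 b.2.2 c.2.1 c.2.2 h)))
        (sub_nonneg.2 (integral_mono (Sg b) (Sg a)
          (fun c => g_mono b.2.1 b.2.2 c.2.1 c.2.2 h)))
    · exact mul_nonneg_of_nonpos_of_nonpos
        (sub_nonpos.2 (integral_mono (Sf a) (Sf b)
          (fun c => f_mono a.2.1 a.2.2 c.2.1 c.2.2 h)))
        (sub_nonpos.2 (integral_mono (Sg a) (Sg b)
          (fun c => g_mono a.2.1 a.2.2 c.2.1 c.2.2 h)))
  · refine integral_mono Iprod Ifg.integral_prod_left (fun d => ?_)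
    refine chebyshev F (Sf d) (Sg d) (Sfg d) ?_
    intro a b
    rw [pstar_comm' d a, pstar_comm' d b, gg_comm d a, gg_comm d b]
    rcases le_total (((a:ℝ) - 1/2)^2) (((b:ℝ) - 1/2)^2) with h | h
    · exact mul_nonneg
        (sub_nonneg.2 (f_mono b.2.1 b.2.2 d.2.1 d.2.2 h))
        (sub_nonneg.2 (g_mono b.2.1 b.2.2 d.2.1 d.2.2 h))
    · exact mul_nonneg_of_nonpos_of_nonpos
        (sub_nonpos.2 (f_mono a.2.1 a.2.2 d.2.1 d.2.2 h))
        (sub_nonpos.2 (g_mono a.2.1 a.2.2 d.2.1 d.2.2 h))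

theorem key_identity : Integrable (fun x : Set.Icc (0:ℝ) 1 × Set.Icc (0:ℝ) 1 => KK x.1 x.2) (F.prod F) ∧
    CF F = (∫ x, KK x.1 x.2 ∂(F.prod F))
      + ((∫ x, binH (pstar (x.1:ℝ) x.2) * gg x.1 x.2 ∂(F.prod F))
      - (∫ x, binH (pstar (x.1:ℝ) x.2) ∂(F.prod F)) * (∫ x, gg x.1 x.2 ∂(F.prod F))) ∧
    0 ≤ VF (Fminus F) ∧ 0 ≤ VF (Fplus F) := by
  have If := bint (F.prod F) meas_f 1 (fun x => f_bound x.1 x.2)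
  have Ig := bint (F.prod F) meas_g 3 (fun x => g_bound x.1 x.2)
  have Ifg : Integrable (fun x : Set.Icc (0:ℝ) 1 × Set.Icc (0:ℝ) 1 =>
      binH (pstar x.1 x.2) * gg x.1 x.2) (F.prod F) :=
    bint (F.prod F) (meas_f.mul meas_g) 3 (fun x => fg_bound x.1 x.2)
  have hbH : ∀ x, 0 ≤ x → x ≤ 1 → |binH x| ≤ 1 := fun x => binH_bound
  have hbH2 : ∀ x, 0 ≤ x → x ≤ 1 → |binH2 x| ≤ 8 / (Real.log 2)^2 := fun x => binH2_bound
  obtain ⟨-, M1⟩ := int_Fminus F meas_binH 1 hbH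
  obtain ⟨IM2, M2⟩ := int_Fminus F meas_binH2 _ hbH2
  obtain ⟨-, P1⟩ := int_Fplus F meas_binH 1 hbH
  obtain ⟨IP2, P2⟩ := int_Fplus F meas_binH2 _ hbH2
  have ch := fun x : Set.Icc (0:ℝ) 1 × Set.Icc (0:ℝ) 1 =>
    chain x.1.2.1 x.1.2.2 x.2.2.1 x.2.2.2
  simp_rw [fun x => (ch x).1] at P1
  have IH : Integrable (fun a : Set.Icc (0:ℝ) 1 => binH a) F :=
    bint F (meas_binH.comp measurable_subtype_coe) 1 (fun x => hbH _ x.2.1 x.2.2)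
  have IH2 : Integrable (fun a : Set.Icc (0:ℝ) 1 => binH2 a) F :=
    bint F (meas_binH2.comp measurable_subtype_coe) _ (fun x => hbH2 _ x.2.1 x.2.2)
  have Ia : Integrable (fun x : Set.Icc (0:ℝ) 1 × Set.Icc (0:ℝ) 1 => binH x.1) (F.prod F) :=
    IH.comp_fst F
  have Ib : Integrable (fun x : Set.Icc (0:ℝ) 1 × Set.Icc (0:ℝ) 1 => binH x.2) (F.prod F) :=
    IH.comp_snd F
  have Ia2 : Integrable (fun x : Set.Icc (0:ℝ) 1 × Set.Icc (0:ℝ) 1 => binH2 x.1) (F.prod F) :=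
    IH2.comp_fst F
  have Ib2 : Integrable (fun x : Set.Icc (0:ℝ) 1 × Set.Icc (0:ℝ) 1 => binH2 x.2) (F.prod F) :=
    IH2.comp_snd F
  have Iab : Integrable (fun x : Set.Icc (0:ℝ) 1 × Set.Icc (0:ℝ) 1 => binH x.1 * binH x.2)
    (F.prod F) := IH.mul_prod IH
  have Ea : ∫ x, binH (x.1:ℝ) ∂(F.prod F) = ∫ a, binH (a:ℝ) ∂F := by
    simpa using integral_fun_fst (μ := F) (ν := F) (fun a : Set.Icc (0:ℝ) 1 => binH a)
  have Eb : ∫ x, binH (x.2:ℝ) ∂(F.prod F) = ∫ a, binH (a:ℝ) ∂F := by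
    simpa using integral_fun_snd (μ := F) (ν := F) (fun a : Set.Icc (0:ℝ) 1 => binH a)
  have Ea2 : ∫ x, binH2 (x.1:ℝ) ∂(F.prod F) = ∫ a, binH2 (a:ℝ) ∂F := by
    simpa using integral_fun_fst (μ := F) (ν := F) (fun a : Set.Icc (0:ℝ) 1 => binH2 a)
  have Eb2 : ∫ x, binH2 (x.2:ℝ) ∂(F.prod F) = ∫ a, binH2 (a:ℝ) ∂F := by
    simpa using integral_fun_snd (μ := F) (ν := F) (fun a : Set.Icc (0:ℝ) 1 => binH2 a)
  have Eab : ∫ x, binH (x.1:ℝ) * binH (x.2:ℝ) ∂(F.prod F)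
      = (∫ a, binH (a:ℝ) ∂F) * ∫ a, binH (a:ℝ) ∂F :=
    integral_prod_mul (μ := F) (ν := F) (fun a : Set.Icc (0:ℝ) 1 => binH a)
      (fun a : Set.Icc (0:ℝ) 1 => binH a)
  -- the sum of the first moments
  have L1 : (∫ x, binH (pstar (x.1:ℝ) x.2) ∂(F.prod F)) + (∫ x, gg x.1 x.2 ∂(F.prod F))
      = (∫ a, binH (a:ℝ) ∂F) + ∫ a, binH (a:ℝ) ∂F := by
    rw [← integral_add If Ig]
    calc _ = ∫ x, (binH (x.1:ℝ) + binH (x.2:ℝ)) ∂(F.prod F) := by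
          congr 1; ext x; unfold gg; ring
      _ = _ := by rw [integral_add Ia Ib, Ea, Eb]
  have eK : (fun x : Set.Icc (0:ℝ) 1 × Set.Icc (0:ℝ) 1 => KK x.1 x.2) = fun x =>
      (((binH2 x.1 + binH2 x.2) + 2 * (binH x.1 * binH x.2))
        - ((pstar x.1 x.2 * binH2 (b0 x.1 x.2) + pstar (1 - x.1) x.2 * binH2 (b1 x.1 x.2))
        + binH2 (pstar x.1 x.2))) / 2 - binH (pstar x.1 x.2) * gg x.1 x.2 := by
    ext x
    linarith [(ch x).2]
  have I0 : Integrable (fun x : Set.Icc (0:ℝ) 1 × Set.Icc (0:ℝ) 1 =>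
      binH2 x.1 + binH2 x.2) (F.prod F) := Ia2.add Ib2
  have I1 : Integrable (fun x : Set.Icc (0:ℝ) 1 × Set.Icc (0:ℝ) 1 =>
      (binH2 x.1 + binH2 x.2) + 2 * (binH x.1 * binH x.2)) (F.prod F) := I0.add (Iab.const_mul 2)
  have I2 : Integrable (fun x : Set.Icc (0:ℝ) 1 × Set.Icc (0:ℝ) 1 =>
      (pstar x.1 x.2 * binH2 (b0 x.1 x.2) + pstar (1 - x.1) x.2 * binH2 (b1 x.1 x.2))
        + binH2 (pstar x.1 x.2)) (F.prod F) := IP2.add IM2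
  have I3 : Integrable (fun x : Set.Icc (0:ℝ) 1 × Set.Icc (0:ℝ) 1 =>
      (((binH2 x.1 + binH2 x.2) + 2 * (binH x.1 * binH x.2))
        - ((pstar x.1 x.2 * binH2 (b0 x.1 x.2) + pstar (1 - x.1) x.2 * binH2 (b1 x.1 x.2))
        + binH2 (pstar x.1 x.2))) / 2) (F.prod F) := (I1.sub I2).div_const 2
  have IK : Integrable (fun x : Set.Icc (0:ℝ) 1 × Set.Icc (0:ℝ) 1 => KK x.1 x.2) (F.prod F) := by
    rw [eK]
    exact I3.sub Ifg
  have LK : ∫ x, KK x.1 x.2 ∂(F.prod F) = (((∫ a, binH2 (a:ℝ) ∂F) + (∫ a, binH2 (a:ℝ) ∂F))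
      + 2 * ((∫ a, binH (a:ℝ) ∂F) * ∫ a, binH (a:ℝ) ∂F)
      - ((∫ a, binH2 (a:ℝ) ∂(Fplus F)) + ∫ a, binH2 (a:ℝ) ∂(Fminus F))) / 2
      - ∫ x, binH (pstar (x.1:ℝ) x.2) * gg x.1 x.2 ∂(F.prod F) := by
    rw [eK, integral_sub I3 Ifg, integral_div, integral_sub I1 I2,
      integral_add I0 (Iab.const_mul 2), integral_add Ia2 Ib2, integral_add IP2 IM2,
      integral_const_mul, Ea2, Eb2, Eab, P2, M2]
  refine ⟨IK, ?_, ?_, ?_⟩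
  · rw [LK]
    unfold CF VF
    rw [M1, P1]
    generalize (∫ a, binH (a:ℝ) ∂F) = A at *
    generalize (∫ x, binH (pstar (x.1:ℝ) x.2) ∂(F.prod F)) = X at *
    generalize (∫ x, gg x.1 x.2 ∂(F.prod F)) = Y at *
    have : A = (X + Y)/2 := by linarith
    rw [this]
    ring
  · unfold VF
    rw [M1, M2, sub_nonneg]
    have Iff : Integrable (fun x : Set.Icc (0:ℝ) 1 × Set.Icc (0:ℝ) 1 =>
      binH (pstar x.1 x.2) * binH (pstar x.1 x.2)) (F.prod F) := by
      refine bint _ (meas_f.mul meas_f) 1 (fun x => ?_)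
      rw [abs_mul]
      exact mul_le_one₀ (f_bound _ _) (abs_nonneg _) (f_bound _ _)
    rw [sq]
    refine (chebyshev _ If If Iff (fun a b => mul_self_nonneg _)).trans
      (integral_mono Iff IM2 (fun x => ?_))
    have := sq_le_binH2 (starMap x).2.1 (starMap x).2.2
    rw [sq] at this
    exact this
  · unfold VF
    rw [P1, P2, sub_nonneg]
    have Igg : Integrable (fun x : Set.Icc (0:ℝ) 1 × Set.Icc (0:ℝ) 1 =>
      gg x.1 x.2 * gg x.1 x.2) (F.prod F) := by
      refine bint _ (meas_g.mul meas_g) 9 (fun x => ?_)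
      rw [abs_mul]
      nlinarith [g_bound x.1 x.2, abs_nonneg (gg x.1 x.2)]
    rw [sq]
    refine (chebyshev _ Ig Ig Igg (fun a b => mul_self_nonneg _)).trans
      (integral_mono Igg IP2 (fun x => ?_))
    change gg x.1 x.2 * gg x.1 x.2 ≤ pstar x.1 x.2 * binH2 (b0 x.1 x.2)
      + pstar (1 - x.1) x.2 * binH2 (b1 x.1 x.2)
    rw [← (ch x).1, pstar_one_sub]
    have h1 := sq_le_binH2 (x := b0 x.1 x.2) (plusMap₁ x).2.1 (plusMap₁ x).2.2
    have h2 := sq_le_binH2 (x := b1 x.1 x.2) (plusMap₂ x).2.1 (plusMap₂ x).2.2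
    have h3 := (starMap x).2.1
    have h4 := (starMap x).2.2
    change 0 ≤ pstar x.1 x.2 at h3
    change pstar x.1 x.2 ≤ 1 at h4
    generalize pstar (x.1:ℝ) x.2 = p at *
    generalize binH (b0 x.1 x.2) = u at *
    generalize binH (b1 x.1 x.2) = v at *
    have h5 := mul_le_mul_of_nonneg_left h1 h3
    have h6 := mul_le_mul_of_nonneg_left h2 (sub_nonneg.2 h4)
    have h7 := mul_nonneg (mul_nonneg h3 (sub_nonneg.2 h4)) (sq_nonneg (u - v))
    nlinarith

theorem binH_zero : binH 0 = 0 := by simp [binH]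
theorem binH_one : binH 1 = 0 := by simp [binH]
theorem logb_half : Real.logb 2 (1/2) = -1 := by
  rw [one_div, Real.logb_inv, Real.logb_self_eq_one (by norm_num)]
theorem binH_half : binH (1/2) = 1 := by
  have : (1:ℝ) - 1/2 = 1/2 := by norm_num
  rw [binH, this, logb_half]; norm_num
theorem binH2_zero : binH2 0 = 0 := by simp [binH2]
theorem binH2_one : binH2 1 = 0 := by simp [binH2]
theorem binH2_half : binH2 (1/2) = 1 := by
  have : (1:ℝ) - 1/2 = 1/2 := by norm_num
  rw [binH2, this, logb_half]; norm_num

theorem three_pt {a c : ℝ} (ha : a = 0 ∨ a = 1/2 ∨ a = 1) (hc : c = 0 ∨ c = 1/2 ∨ c = 1) :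
    binH (pstar a c) = binH a + binH c - binH a * binH c ∧ gg a c = binH a * binH c ∧
    binH (pstar a c) * gg a c = binH a * binH c := by
  have p00 : pstar 0 0 = 1 := by norm_num [pstar]
  have p01 : pstar 0 1 = 0 := by norm_num [pstar]
  have p10 : pstar 1 0 = 0 := by norm_num [pstar]
  have p11 : pstar 1 1 = 1 := by norm_num [pstar]
  have pl : ∀ t, pstar (1/2) t = 1/2 := by intro t; unfold pstar; ring
  have pr : ∀ t, pstar t (1/2) = 1/2 := by intro t; unfold pstar; ring
  have h1 : binH (pstar a c) = binH a + binH c - binH a * binH c := by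
    rcases ha with rfl | rfl | rfl <;> rcases hc with rfl | rfl | rfl
    all_goals
      simp only [p00, p01, p10, p11, pl, pr, binH_half, binH_zero, binH_one]
      norm_num
  have h2 : gg a c = binH a * binH c := by unfold gg; rw [h1]; ring
  refine ⟨h1, h2, ?_⟩
  rw [h1, h2]
  have e1 : binH a * binH a = binH a := by
    rcases ha with rfl | rfl | rfl <;> simp only [binH_half, binH_zero, binH_one] <;> norm_num
  have e2 : binH c * binH c = binH c := by
    rcases hc with rfl | rfl | rfl <;> simp only [binH_half, binH_zero, binH_one] <;> norm_num
  calc _ = (binH a * binH a) * binH c + binH a * (binH c * binH c)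
        - (binH a * binH a) * (binH c * binH c) := by ring
    _ = _ := by rw [e1, e2]; ring

theorem VF_zero (hK : ∫ x, KK x.1 x.2 ∂(F.prod F) = 0)
    (hc : (∫ x, binH (pstar (x.1:ℝ) x.2) * gg x.1 x.2 ∂(F.prod F))
      = (∫ x, binH (pstar (x.1:ℝ) x.2) ∂(F.prod F)) * (∫ x, gg x.1 x.2 ∂(F.prod F))) :
    VF F = 0 := by
  obtain ⟨IK, -⟩ := key_identity F
  have hK0 := (integral_eq_zero_iff_of_nonneg
    (fun x => KK_nonneg x.1.2.1 x.1.2.2 x.2.2.1 x.2.2.2) IK).1 hK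
  let S : Set (Set.Icc (0:ℝ) 1) := {a | ¬ ((a:ℝ) = 0 ∨ (a:ℝ) = 1/2 ∨ (a:ℝ) = 1)}
  have hS : (F.prod F) (S ×ˢ S) = 0 := by
    refine measure_mono_null ?_ (ae_iff.1 hK0)
    rintro ⟨a, c⟩ ⟨ha, hc⟩
    simp only [S, Set.mem_ofPred_eq, not_or] at ha hc
    obtain ⟨a0, ah, a1⟩ := ha
    obtain ⟨c0, ch, c1⟩ := hc
    exact (KK_pos (lt_of_le_of_ne a.2.1 (Ne.symm a0)) (lt_of_le_of_ne a.2.2 a1)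
      (lt_of_le_of_ne c.2.1 (Ne.symm c0)) (lt_of_le_of_ne c.2.2 c1) ah ch).ne'
  rw [Measure.prod_prod, mul_self_eq_zero] at hS
  have hae : ∀ᵐ a : Set.Icc (0:ℝ) 1 ∂F, (a:ℝ) = 0 ∨ (a:ℝ) = 1/2 ∨ (a:ℝ) = 1 := ae_iff.2 hS
  have h1 := Measure.quasiMeasurePreserving_fst (μ := F) (ν := F) |>.ae hae
  have h2 := Measure.quasiMeasurePreserving_snd (μ := F) (ν := F) |>.ae hae
  have IH : Integrable (fun a : Set.Icc (0:ℝ) 1 => binH a) F :=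
    bint F (meas_binH.comp measurable_subtype_coe) 1 (fun x => binH_bound x.2.1 x.2.2)
  have Ea : ∫ x, binH (x.1:ℝ) ∂(F.prod F) = ∫ a, binH (a:ℝ) ∂F := by
    simpa using integral_fun_fst (μ := F) (ν := F) (fun a : Set.Icc (0:ℝ) 1 => binH a)
  have Eb : ∫ x, binH (x.2:ℝ) ∂(F.prod F) = ∫ a, binH (a:ℝ) ∂F := by
    simpa using integral_fun_snd (μ := F) (ν := F) (fun a : Set.Icc (0:ℝ) 1 => binH a)
  have Eab : ∫ x, binH (x.1:ℝ) * binH (x.2:ℝ) ∂(F.prod F)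
      = (∫ a, binH (a:ℝ) ∂F) * ∫ a, binH (a:ℝ) ∂F :=
    integral_prod_mul (μ := F) (ν := F) (fun a : Set.Icc (0:ℝ) 1 => binH a)
      (fun a : Set.Icc (0:ℝ) 1 => binH a)
  have Ia : Integrable (fun x : Set.Icc (0:ℝ) 1 × Set.Icc (0:ℝ) 1 => binH x.1) (F.prod F) :=
    IH.comp_fst F
  have Ib : Integrable (fun x : Set.Icc (0:ℝ) 1 × Set.Icc (0:ℝ) 1 => binH x.2) (F.prod F) :=
    IH.comp_snd F
  have Iab : Integrable (fun x : Set.Icc (0:ℝ) 1 × Set.Icc (0:ℝ) 1 => binH x.1 * binH x.2)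
    (F.prod F) := IH.mul_prod IH
  have e1 : ∫ x, binH (pstar (x.1:ℝ) x.2) * gg x.1 x.2 ∂(F.prod F)
      = ∫ x, binH (x.1:ℝ) * binH (x.2:ℝ) ∂(F.prod F) := by
    apply integral_congr_ae
    filter_upwards [h1, h2] with x hx hy using (three_pt hx hy).2.2
  have e2 : ∫ x, gg x.1 x.2 ∂(F.prod F)
      = ∫ x, binH (x.1:ℝ) * binH (x.2:ℝ) ∂(F.prod F) := by
    apply integral_congr_ae
    filter_upwards [h1, h2] with x hx hy using (three_pt hx hy).2.1
  have e3 : ∫ x, binH (pstar (x.1:ℝ) x.2) ∂(F.prod F)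
      = ∫ x, (binH (x.1:ℝ) + binH (x.2:ℝ) - binH (x.1:ℝ) * binH (x.2:ℝ)) ∂(F.prod F) := by
    apply integral_congr_ae
    filter_upwards [h1, h2] with x hx hy using (three_pt hx hy).1
  have e4 : ∫ a, binH2 (a:ℝ) ∂F = ∫ a, binH (a:ℝ) ∂F := by
    apply integral_congr_ae
    filter_upwards [hae] with a ha
    rcases ha with h | h | h <;> rw [h] <;>
      simp only [binH_half, binH_zero, binH_one, binH2_half, binH2_zero, binH2_one]
  have e5 : ∫ x, (binH (x.1:ℝ) + binH (x.2:ℝ) - binH (x.1:ℝ) * binH (x.2:ℝ)) ∂(F.prod F)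
      = (∫ a, binH (a:ℝ) ∂F) + (∫ a, binH (a:ℝ) ∂F)
        - (∫ a, binH (a:ℝ) ∂F) * ∫ a, binH (a:ℝ) ∂F := by
    erw [integral_sub (Ia.add Ib) Iab, integral_add Ia Ib]
    rw [Ea, Eb, Eab]
  rw [e1, e2, e3, e5, Eab] at hc
  unfold VF
  rw [e4]
  generalize (∫ a, binH (a:ℝ) ∂F) = t at *
  have h : (t - t^2)^2 = 0 := by linarith
  exact pow_eq_zero_iff (by norm_num) |>.1 h

end


/-- For every Borel probability measure `F` on `[0,1]`, `C(F) ≥ 0` (equivalently,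
`V(F⁻) + V(F⁺) ≤ 2 V(F)`), with `C(F) = 0` iff `V(F) = 0`. -/
theorem CF_nonneg_and_eq_zero_iff
    (F : Measure (Set.Icc (0:ℝ) 1)) [IsProbabilityMeasure F] :
    0 ≤ CF F ∧ VF (Fminus F) + VF (Fplus F) ≤ 2 * VF F ∧ (CF F = 0 ↔ VF F = 0) := by
  obtain ⟨-, hC, hm, hp⟩ := key_identity F
  have hK : 0 ≤ ∫ x, KK x.1 x.2 ∂(F.prod F) :=
    integral_nonneg (fun x => KK_nonneg x.1.2.1 x.1.2.2 x.2.2.1 x.2.2.2)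
  have hH := harris F
  have h0 : 0 ≤ CF F := by rw [hC]; linarith
  refine ⟨h0, ?_, ?_, ?_⟩
  · unfold CF at h0; linarith
  · intro h
    rw [hC] at h
    exact VF_zero F (by linarith) (by linarith)
  · intro h
    have : CF F = VF F - (VF (Fminus F) + VF (Fplus F)) / 2 := rfl
    linarith
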